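/- arXiv:1904.11606 — 8 statements merged into one kernel-verified Lean document; each statement's English description precedes it below -/
import Mathlib

section
/- Let U ⊆ V with |U| = k ≥ 28. Then the number of vertices v ∈ U such that |T_v ∩ U| > 8·|S_v ∩ U| is strictly less than k/4. (This is the counting claim established in the proof of Lemma 3.1; the hypothesis k ≥ 28 is needed for the counting argument to go through.) -/
/-- The counting claim in the proof of Lemma 3.1: for a tournament relation `R` on a finite
type `V` and a finite set `U ⊆ V` with `|U| = k ≥ 28`, the number of vertices `v ∈ U` with
`|T_v ∩ U| > 8 |S_v ∩ U|` is strictly less than `k / 4`, where `S_v = {u : R u v}` and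
`T_v = {u : R v u}`. -/
theorem stmt0 {V : Type*} [Fintype V] [DecidableEq V]
    (R : V → V → Prop) [DecidableRel R]
    (hirr : ∀ v, ¬ R v v)
    (htour : ∀ u v : V, u ≠ v → (R u v ∧ ¬ R v u) ∨ (R v u ∧ ¬ R u v))
    (U : Finset V) (hk : 28 ≤ U.card) :
    4 * (U.filter (fun v =>
        8 * (U.filter (fun u => R u v)).card < (U.filter (fun u => R v u)).card)).card
      < U.card := by
  have key : ∀ (W : Finset V), ∀ v ∈ W,
      (W.filter (fun u => R u v)).card + (W.filter (fun u => R v u)).card + 1 = W.card := by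
    intro W v hv
    have h1 : Disjoint (W.filter (fun u => R u v)) (W.filter (fun u => R v u)) := by
      rw [Finset.disjoint_left]
      intro u h1 h2
      simp only [Finset.mem_filter] at h1 h2
      by_cases h : u = v
      · subst h
        exact hirr _ h1.2
      · rcases htour u v h with h | h
        · exact h.2 h2.2
        · exact h.2 h1.2
    rw [← Finset.card_union_of_disjoint h1, ← Finset.card_erase_add_one hv]
    congr 2
    ext u
    simp only [Finset.mem_union, Finset.mem_filter, Finset.mem_erase]
    by_cases h : u = v
    · subst h
      simp [hirr]
    · have := htour u v h
      tauto
  by_contra hcon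
  push Not at hcon
  set B := U.filter (fun v =>
        8 * (U.filter (fun u => R u v)).card < (U.filter (fun u => R v u)).card) with hB
  have hBU : B ⊆ U := Finset.filter_subset _ _
  have hsum : ∑ v ∈ B, (B.filter (fun u => R v u)).card
      = ∑ v ∈ B, (B.filter (fun u => R u v)).card :=
    Finset.sum_card_bipartiteAbove_eq_sum_card_bipartiteBelow R
  have htot : ∑ v ∈ B, ((B.filter (fun u => R u v)).card + (B.filter (fun u => R v u)).card + 1)
      = B.card * B.card := by
    rw [Finset.sum_congr rfl (key B), Finset.sum_const, smul_eq_mul]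
  rw [Finset.sum_add_distrib, Finset.sum_add_distrib, hsum, Finset.sum_const, smul_eq_mul] at htot
  have hle : ∑ v ∈ B, (9 * (B.filter (fun u => R u v)).card + 2) ≤ ∑ v ∈ B, U.card := by
    apply Finset.sum_le_sum
    intro v hv
    have h1 := key U v (hBU hv)
    have h2 := (Finset.mem_filter.mp hv).2
    have h3 : (B.filter (fun u => R u v)).card ≤ (U.filter (fun u => R u v)).card :=
      Finset.card_le_card (Finset.filter_subset_filter _ hBU)
    omega
  rw [Finset.sum_add_distrib, ← Finset.mul_sum, Finset.sum_const, Finset.sum_const, smul_eq_mul,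
    smul_eq_mul] at hle
  have hb : 7 ≤ B.card := by omega
  nlinarith
end

section
/- Let U ⊆ V with |U| = k ≥ 28. Then strictly more than k/2 of the vertices v ∈ U satisfy |S_v ∩ U|/8 ≤ |T_v ∩ U| ≤ 8·|S_v ∩ U|. (Lemma 3.1 of the paper; a size hypothesis such as k ≥ 28 is needed, since for very small k, e.g. a transitive tournament on 3 or 4 vertices, the conclusion fails.) -/
theorem aux_split {V : Type*} [DecidableEq V]
    (R : V → V → Prop) [DecidableRel R]
    (hirr : ∀ v, ¬ R v v)
    (htour : ∀ u v : V, u ≠ v → (R u v ∧ ¬ R v u) ∨ (R v u ∧ ¬ R u v))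
    (A : Finset V) (v : V) (hv : v ∈ A) :
    (A.filter (fun u => R u v)).card + (A.filter (fun u => R v u)).card + 1 = A.card := by
  have h1 : A.filter (fun u => R v u) = (A.filter (fun u => ¬ R u v)).erase v := by
    ext u
    simp only [Finset.mem_filter, Finset.mem_erase]
    constructor
    · rintro ⟨hu, h⟩
      have hne : u ≠ v := by
        rintro rfl
        exact hirr _ h
      have := htour u v hne
      tauto
    · rintro ⟨hne, hu, h⟩
      have := htour u v hne
      tauto
  have h2 : v ∈ A.filter (fun u => ¬ R u v) := by
    simp [hv, hirr]
  have h3 := Finset.card_erase_add_one h2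
  have h4 := Finset.card_filter_add_card_filter_not (s := A) (fun u => R u v)
  rw [h1]
  omega

theorem aux_bound {V : Type*} [DecidableEq V]
    (R : V → V → Prop) [DecidableRel R]
    (hirr : ∀ v, ¬ R v v)
    (htour : ∀ u v : V, u ≠ v → (R u v ∧ ¬ R v u) ∨ (R v u ∧ ¬ R u v))
    (A : Finset V) (t : ℕ)
    (ht : ∀ v ∈ A, (A.filter (fun u => R v u)).card ≤ t) :
    A.card ≤ 2 * t + 1 := by
  have h1 : ∑ v ∈ A, (A.filter (fun u => R v u)).card
      = ∑ v ∈ A, (A.filter (fun u => R u v)).card :=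
    Finset.sum_card_bipartiteAbove_eq_sum_card_bipartiteBelow (s := A) (t := A) R
  have h2 : ∑ v ∈ A, ((A.filter (fun u => R u v)).card + (A.filter (fun u => R v u)).card + 1)
      = ∑ v ∈ A, A.card :=
    Finset.sum_congr rfl (fun v hv => aux_split R hirr htour A v hv)
  have h3 := Finset.sum_le_card_nsmul A _ t ht
  simp only [Finset.sum_add_distrib, Finset.sum_const, smul_eq_mul, mul_one] at h2 h3
  rcases Nat.eq_zero_or_pos A.card with h0 | h0
  · omega
  · refine Nat.le_of_mul_le_mul_left ?_ h0
    nlinarith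

/-- Lemma 3.1: for a tournament relation `R` on a finite type `V` and a finite set `U`
with `|U| = k ≥ 28`, strictly more than `k / 2` of the vertices `v ∈ U` satisfy
`|S_v ∩ U| / 8 ≤ |T_v ∩ U| ≤ 8 |S_v ∩ U|`, where `S_v = {u : R u v}` and `T_v = {u : R v u}`. -/
theorem stmt1 {V : Type*} [Fintype V] [DecidableEq V]
    (R : V → V → Prop) [DecidableRel R]
    (hirr : ∀ v, ¬ R v v)
    (htour : ∀ u v : V, u ≠ v → (R u v ∧ ¬ R v u) ∨ (R v u ∧ ¬ R u v))
    (U : Finset V) (hk : 28 ≤ U.card) :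
    U.card < 2 * (U.filter (fun v =>
        (U.filter (fun u => R u v)).card ≤ 8 * (U.filter (fun u => R v u)).card ∧
        (U.filter (fun u => R v u)).card ≤ 8 * (U.filter (fun u => R u v)).card)).card := by
  classical
  have hs := aux_split R hirr htour U
  have b1 := aux_bound R hirr htour
    (U.filter (fun v => 8 * (U.filter (fun u => R v u)).card < (U.filter (fun u => R u v)).card))
    ((U.card - 2) / 9) (by
      intro v hv
      rw [Finset.mem_filter] at hv
      have h1 := hs v hv.1
      refine (Finset.card_le_card
        (Finset.filter_subset_filter _ (Finset.filter_subset _ U))).trans ?_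
      omega)
  have b2 := aux_bound (fun u v => R v u) hirr (fun u v h => htour v u h.symm)
    (U.filter (fun v => 8 * (U.filter (fun u => R u v)).card < (U.filter (fun u => R v u)).card))
    ((U.card - 2) / 9) (by
      intro v hv
      rw [Finset.mem_filter] at hv
      have h1 := hs v hv.1
      refine (Finset.card_le_card
        (Finset.filter_subset_filter _ (Finset.filter_subset _ U))).trans ?_
      omega)
  have h4 := Finset.card_filter_add_card_filter_not (s := U) (fun v =>
        (U.filter (fun u => R u v)).card ≤ 8 * (U.filter (fun u => R v u)).card ∧
        (U.filter (fun u => R v u)).card ≤ 8 * (U.filter (fun u => R u v)).card)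
  simp only [not_and_or, not_le, Finset.filter_or] at h4
  have h5 := Finset.card_union_le
    (U.filter (fun v => 8 * (U.filter (fun u => R v u)).card < (U.filter (fun u => R u v)).card))
    (U.filter (fun v => 8 * (U.filter (fun u => R u v)).card < (U.filter (fun u => R v u)).card))
  omega
end

section
/- Let s*, t*, v ∈ V and D ∈ [0,∞] with d_min(s*, t*) ≥ D. If either (d(s*, v) ≤ d(v, s*) and d(v, t*) ≤ d(t*, v)) or (d(t*, v) ≤ d(v, t*) and d(v, s*) ≤ d(s*, v)), then ε(v) ≥ D/2. (Lemma 4.1: if the min-diameter endpoints s* and t* are split by v, i.e. one lies in S_v and the other in T_v, then the min-eccentricity of v is at least half the min-diameter.) -/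
open scoped ENNReal

/-- Lemma 4.1: if `d_min(s*, t*) ≥ D` and the endpoints `s*`, `t*` are split by `v`
(one lies in `S_v`, the other in `T_v`), then the min-eccentricity of `v` is at least
`D / 2`. -/
theorem stmt3 {V : Type*} [Fintype V] (d : V → V → ℝ≥0∞)
    (hrefl : ∀ v, d v v = 0)
    (htri : ∀ u v w, d u w ≤ d u v + d v w)
    (s t v : V) (D : ℝ≥0∞)
    (hD : D ≤ min (d s t) (d t s))
    (hsplit : (d s v ≤ d v s ∧ d v t ≤ d t v) ∨ (d t v ≤ d v t ∧ d v s ≤ d s v)) :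
    D / 2 ≤ ⨆ u : V, min (d u v) (d v u) := by
  have hs := le_iSup (fun u : V => min (d u v) (d v u)) s
  have ht := le_iSup (fun u : V => min (d u v) (d v u)) t
  apply ENNReal.div_le_of_le_mul
  rw [mul_two]
  rcases hsplit with ⟨h1, h2⟩ | ⟨h1, h2⟩
  · simp only [min_eq_left h1] at hs
    simp only [min_eq_right h2] at ht
    exact (hD.trans (min_le_left _ _)).trans ((htri s v t).trans (add_le_add hs ht))
  · simp only [min_eq_right h2] at hs
    simp only [min_eq_left h1] at ht
    exact (hD.trans (min_le_right _ _)).trans ((htri t v s).trans (add_le_add ht hs))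
end

section
/- Assume additionally the coverage hypothesis: for every x ∈ V ∖ V_i there exists a ∈ W such that either (x ∈ T_a ∪ {a} and V_i ⊆ S_a) or (x ∈ S_a ∪ {a} and V_i ⊆ T_a). Then for every pair of vertices u, v ∈ V_i, min( d_{G_i^S}(u,v), d_{G_i^T}(u,v) ) ≤ d(u,v). (Lemma 4.2: distances in the augmented graphs never overestimate distances in the original graph.) -/
open scoped ENNReal Classical

noncomputable section

/-- Total weight of a walk, given as the list of its vertices; weight `⊤` encodes a
missing edge. -/
def walkCost {α : Type*} (w : α → α → ℝ≥0∞) : List α → ℝ≥0∞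
  | [] => 0
  | [_] => 0
  | a :: b :: rest => w a b + walkCost w (b :: rest)

/-- Shortest-path distance in the weighted directed graph with weight function `w`
(`w x y = ⊤` means there is no edge from `x` to `y`): the infimum over directed walks
from `u` to `v` of their total weight. -/
def spDist {α : Type*} (w : α → α → ℝ≥0∞) (u v : α) : ℝ≥0∞ :=
  ⨅ (l : List α) (_ : l.head? = some u ∧ l.getLast? = some v), walkCost w l

/-- The augmented graph `G_i^S` on vertex set `V_i ∪ {h_S}` (`none` is the extra hub
vertex `h_S`): it keeps the edges of `G` inside `V_i`, has a weight-`0` edge from each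
`u ∈ V_i` to `h_S`, and an edge from `h_S` to each `v ∈ V_i` of weight
`max 0 (min_{a ∈ W_i^S} d(a, v) − D')` whenever `W_i^S ≠ ∅` and that minimum is finite. -/
def augS {V : Type*} (wG : V → V → ℝ≥0∞) (Vi WiS : Set V) (D' : ℝ≥0∞) :
    Option V → Option V → ℝ≥0∞
  | some u, some v => if u ∈ Vi ∧ v ∈ Vi then wG u v else ⊤
  | some u, none => if u ∈ Vi then 0 else ⊤
  | none, some v =>
      if v ∈ Vi ∧ WiS.Nonempty ∧ (⨅ a ∈ WiS, spDist wG a v) ≠ ⊤ then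
        (⨅ a ∈ WiS, spDist wG a v) - D'
      else ⊤
  | none, none => ⊤

/-- The augmented graph `G_i^T` on vertex set `V_i ∪ {h_T}` (`none` is the extra hub
vertex `h_T`): it keeps the edges of `G` inside `V_i`, has a weight-`0` edge from `h_T`
to each `v ∈ V_i`, and an edge from each `u ∈ V_i` to `h_T` of weight
`max 0 (min_{a ∈ W_i^T} d(u, a) − D')` whenever `W_i^T ≠ ∅` and that minimum is finite. -/
def augT {V : Type*} (wG : V → V → ℝ≥0∞) (Vi WiT : Set V) (D' : ℝ≥0∞) :
    Option V → Option V → ℝ≥0∞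
  | some u, some v => if u ∈ Vi ∧ v ∈ Vi then wG u v else ⊤
  | none, some v => if v ∈ Vi then 0 else ⊤
  | some u, none =>
      if u ∈ Vi ∧ WiT.Nonempty ∧ (⨅ a ∈ WiT, spDist wG u a) ≠ ⊤ then
        (⨅ a ∈ WiT, spDist wG u a) - D'
      else ⊤
  | none, none => ⊤

theorem walkCost_split {α : Type*} (w : α → α → ℝ≥0∞) (x : α) (l2 : List α) :
    ∀ l1 : List α, walkCost w (l1 ++ x :: l2) = walkCost w (l1 ++ [x]) + walkCost w (x :: l2)
  | [] => by simp [walkCost]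
  | [a] => by simp [walkCost]
  | a :: b :: r => by
      have ih := walkCost_split w x l2 (b :: r)
      simp only [List.cons_append, walkCost] at ih ⊢
      rw [ih, add_assoc]

theorem spDist_le_walk {α : Type*} (w : α → α → ℝ≥0∞) {u v : α} (l : List α)
    (h1 : l.head? = some u) (h2 : l.getLast? = some v) : spDist w u v ≤ walkCost w l :=
  iInf₂_le l ⟨h1, h2⟩

theorem spDist_self_zero {α : Type*} (w : α → α → ℝ≥0∞) (u : α) : spDist w u u = 0 :=
  le_antisymm (spDist_le_walk w [u] rfl rfl) zero_le

theorem spDist_tri {α : Type*} (w : α → α → ℝ≥0∞) (a x v : α) :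
    spDist w a v ≤ spDist w a x + spDist w x v := by
  unfold spDist
  simp only [iInf_subtype', ENNReal.iInf_add, ENNReal.add_iInf]
  refine le_iInf fun ⟨m, hm1, hm2⟩ => le_iInf fun ⟨l, hl1, hl2⟩ => ?_
  obtain ⟨l', rfl⟩ := List.getLast?_eq_some_iff.1 hl2
  obtain ⟨m', rfl⟩ := List.head?_eq_some_iff.1 hm1
  show _ ≤ walkCost w (l' ++ [x]) + walkCost w (x :: m')
  rw [← walkCost_split]
  refine iInf_le_of_le ⟨l' ++ x :: m', ?_, ?_⟩ le_rfl
  · cases l' <;> simpa using hl1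
  · simpa using hm2

theorem walkCost_map_some {V : Type*} (wG : V → V → ℝ≥0∞) (Vi A : Set V) (D' : ℝ≥0∞) :
    ∀ l : List V, (∀ x ∈ l, x ∈ Vi) →
      walkCost (augS wG Vi A D') (l.map some) = walkCost wG l
  | [], _ => rfl
  | [_], _ => rfl
  | a :: b :: r, h => by
      have ih := walkCost_map_some wG Vi A D' (b :: r) (fun x hx => h x (by simp [hx]))
      simp only [List.map_cons, walkCost] at ih ⊢
      rw [ih]
      simp [augS, h a (by simp), h b (by simp)]

/-- Lemma 4.2: under the coverage hypothesis, for all `u, v ∈ V_i`,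
`min (d_{G_i^S}(u,v), d_{G_i^T}(u,v)) ≤ d(u,v)`. -/
theorem stmt4 {V : Type*} [Fintype V]
    (wG : V → V → ℝ≥0∞)
    (W : Set V) (D' : ℝ≥0∞) (hD'top : D' ≠ ⊤)
    (hW : ∀ a ∈ W, ∀ x : V, min (spDist wG a x) (spDist wG x a) ≤ D')
    (S T : V → Set V)
    (hSa : ∀ a ∈ W, a ∉ S a) (hTa : ∀ a ∈ W, a ∉ T a)
    (hpart : ∀ a ∈ W, ∀ u : V, u ≠ a → (u ∈ S a ∧ u ∉ T a) ∨ (u ∈ T a ∧ u ∉ S a))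
    (hS : ∀ a ∈ W, ∀ u ∈ S a, spDist wG u a ≤ spDist wG a u)
    (hT : ∀ a ∈ W, ∀ u ∈ T a, spDist wG a u ≤ spDist wG u a)
    (Vi : Set V) (hViW : Disjoint Vi W)
    (hcover : ∀ x : V, x ∉ Vi → ∃ a ∈ W,
        ((x ∈ T a ∨ x = a) ∧ Vi ⊆ S a) ∨ ((x ∈ S a ∨ x = a) ∧ Vi ⊆ T a))
    (u v : V) (hu : u ∈ Vi) (hv : v ∈ Vi) :
    min (spDist (augS wG Vi {a ∈ W | Vi ⊆ S a} D') (some u) (some v))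
        (spDist (augT wG Vi {a ∈ W | Vi ⊆ T a} D') (some u) (some v))
      ≤ spDist wG u v := by
  refine le_iInf₂ fun l hl => ?_
  obtain ⟨hl1, hl2⟩ := hl
  by_cases hall : ∀ x ∈ l, x ∈ Vi
  · refine (min_le_left _ _).trans ?_
    rw [← walkCost_map_some wG Vi {a ∈ W | Vi ⊆ S a} D' l hall]
    exact spDist_le_walk _ _ (by simp [hl1]) (by simp [hl2])
  push Not at hall
  obtain ⟨x, hxl, hx⟩ := hall
  by_cases htop : walkCost wG l = ⊤
  · rw [htop]; exact le_top
  obtain ⟨l1, l2, rfl⟩ := List.append_of_mem hxl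
  rw [walkCost_split] at htop ⊢
  have hux : spDist wG u x ≤ walkCost wG (l1 ++ [x]) :=
    spDist_le_walk _ _ (by cases l1 <;> simpa using hl1) (by simp)
  have hxv : spDist wG x v ≤ walkCost wG (x :: l2) :=
    spDist_le_walk _ _ (by simp) (by simpa using hl2)
  rw [ENNReal.add_eq_top, not_or] at htop
  obtain ⟨a, haW, ⟨hxa, hVi⟩ | ⟨hxa, hVi⟩⟩ := hcover x hx
  · refine (min_le_left _ _).trans ?_
    have hax : spDist wG a x ≤ D' := by
      rcases hxa with h | rfl
      · have := hW a haW x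
        rwa [min_eq_left (hT a haW x h)] at this
      · simp [spDist_self_zero]
    have hinf : (⨅ b ∈ {a ∈ W | Vi ⊆ S a}, spDist wG b v) ≤ D' + walkCost wG (x :: l2) :=
      (iInf₂_le a ⟨haW, hVi⟩).trans ((spDist_tri wG a x v).trans (add_le_add hax hxv))
    have hne := ne_top_of_le_ne_top (ENNReal.add_ne_top.2 ⟨hD'top, htop.2⟩) hinf
    refine (spDist_le_walk _ [some u, none, some v] rfl rfl).trans ?_
    have hcond : v ∈ Vi ∧ ({a ∈ W | Vi ⊆ S a} : Set V).Nonempty ∧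
      (⨅ b ∈ {a ∈ W | Vi ⊆ S a}, spDist wG b v) ≠ ⊤ := ⟨hv, ⟨a, haW, hVi⟩, hne⟩
    simp only [walkCost, augS, if_pos hu, if_pos hcond, zero_add, add_zero]
    exact (tsub_le_iff_left.2 hinf).trans le_add_self
  · refine (min_le_right _ _).trans ?_
    have hax : spDist wG x a ≤ D' := by
      rcases hxa with h | rfl
      · have := hW a haW x
        rwa [min_eq_right (hS a haW x h)] at this
      · simp [spDist_self_zero]
    have hinf : (⨅ b ∈ {a ∈ W | Vi ⊆ T a}, spDist wG u b) ≤ walkCost wG (l1 ++ [x]) + D' :=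
      (iInf₂_le a ⟨haW, hVi⟩).trans ((spDist_tri wG u x a).trans (add_le_add hux hax))
    have hne := ne_top_of_le_ne_top (ENNReal.add_ne_top.2 ⟨htop.1, hD'top⟩) hinf
    refine (spDist_le_walk _ [some u, none, some v] rfl rfl).trans ?_
    have hcond : u ∈ Vi ∧ ({a ∈ W | Vi ⊆ T a} : Set V).Nonempty ∧
      (⨅ b ∈ {a ∈ W | Vi ⊆ T a}, spDist wG u b) ≠ ⊤ := ⟨hu, ⟨a, haW, hVi⟩, hne⟩
    simp only [walkCost, augT, if_pos hv, if_pos hcond, zero_add, add_zero]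
    exact (tsub_le_iff_right.2 hinf).trans le_self_add

end
end

section
/- Let r ∈ [0,∞) and let c ∈ V satisfy ε(c) ≤ r. Suppose x_0, x_1, …, x_t ∈ V with t ≥ 1 form a path in the 'far graph', i.e. d_min(x_s, x_{s+1}) > 2r for every 0 ≤ s < t. Then each x_s satisfies exactly one of d(x_s, c) ≤ r and d(c, x_s) ≤ r, and moreover d(x_0, c) ≤ r if and only if d(x_t, c) ≤ r, and d(c, x_0) ≤ r if and only if d(c, x_t) ≤ r. (This is the content of Lemma 5.2: if the min-radius is at most r, then for each connected component F of the far graph — vertices joined by edges whenever their min-distance exceeds 2r — the min-center lies on the same side, S or T, of every vertex of F.) -/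
open scoped ENNReal

/-- The content of Lemma 5.2: if `ε(c) ≤ r` and `x_0, …, x_t` (with `t ≥ 1`) is a path in
the far graph (consecutive vertices have min-distance `> 2r`), then every `x_s` satisfies
exactly one of `d(x_s, c) ≤ r` and `d(c, x_s) ≤ r`, and the side is constant along the
path: `d(x_0, c) ≤ r ↔ d(x_t, c) ≤ r` and `d(c, x_0) ≤ r ↔ d(c, x_t) ≤ r`. -/
theorem stmt7 {V : Type*} [Fintype V] (d : V → V → ℝ≥0∞)
    (hrefl : ∀ v, d v v = 0)
    (htri : ∀ u v w, d u w ≤ d u v + d v w)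
    (r : ℝ≥0∞) (hr : r ≠ ⊤)
    (c : V) (hc : (⨆ u : V, min (d u c) (d c u)) ≤ r)
    (t : ℕ) (ht : 1 ≤ t) (x : ℕ → V)
    (hfar : ∀ s < t, 2 * r < min (d (x s) (x (s + 1))) (d (x (s + 1)) (x s))) :
    (∀ s ≤ t, (d (x s) c ≤ r ∧ ¬ d c (x s) ≤ r) ∨ (d c (x s) ≤ r ∧ ¬ d (x s) c ≤ r)) ∧
    (d (x 0) c ≤ r ↔ d (x t) c ≤ r) ∧
    (d c (x 0) ≤ r ↔ d c (x t) ≤ r) := by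
  have h1 : ∀ u, d u c ≤ r ∨ d c u ≤ r := fun u =>
    min_le_iff.mp ((le_iSup (fun u => min (d u c) (d c u)) u).trans hc)
  have h2 : ∀ a b, 2 * r < d a b → ¬ (d a c ≤ r ∧ d c b ≤ r) := by
    rintro a b h ⟨ha, hb⟩
    have h3 := (htri a c b).trans (add_le_add ha hb)
    rw [← two_mul] at h3
    exact absurd h (not_lt.mpr h3)
  have step : ∀ s < t,
      (d (x s) c ≤ r ∧ ¬ d c (x s) ≤ r ∧ d (x (s+1)) c ≤ r ∧ ¬ d c (x (s+1)) ≤ r) ∨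
      (¬ d (x s) c ≤ r ∧ d c (x s) ≤ r ∧ ¬ d (x (s+1)) c ≤ r ∧ d c (x (s+1)) ≤ r) := by
    intro s hs
    have hf := lt_min_iff.mp (hfar s hs)
    have ha := h2 _ _ hf.1
    have hb := h2 _ _ hf.2
    have hx := h1 (x s)
    have hy := h1 (x (s+1))
    tauto
  have inv : ∀ s ≤ t, (d (x 0) c ≤ r ↔ d (x s) c ≤ r) ∧ (d c (x 0) ≤ r ↔ d c (x s) ≤ r) := by
    intro s
    induction s with
    | zero => intro _; exact ⟨Iff.rfl, Iff.rfl⟩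
    | succ k ih =>
      intro hk
      have h4 := ih (by omega)
      have h5 := step k (by omega)
      tauto
  refine ⟨fun s hs => ?_, inv t le_rfl⟩
  have h4 := inv s hs
  have h5 := step 0 (by omega)
  tauto
end

section
/- Let r ∈ [0,∞), let k ≥ 1, and let W_1, …, W_k ⊆ V be nonempty sets such that for all 1 ≤ i < j ≤ k, every a ∈ W_i and b ∈ W_j satisfy d(b, a) > 5r (the 'backedge' property of the ordered supercomponents). Let c ∈ V satisfy ε(c) ≤ r, and suppose that for each i ∈ {1, …, k} either (d(c, w) ≤ d(w, c) for all w ∈ W_i) or (d(w, c) ≤ d(c, w) for all w ∈ W_i). Then there exists i ∈ {1, …, k+1} such that d(w, c) ≤ 2r for every w ∈ W_j with j < i, and d(c, w) ≤ 2r for every w ∈ W_j with j ≥ i. (This is Lemma 5.4: under the conclusion of Lemma 5.3 — that the min-center c lies entirely on the S-side or entirely on the T-side of each supercomponent — c belongs to one of the sets C_1, …, C_{k+1} fitting into the DAG-like ordering of supercomponents.) -/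
open scoped ENNReal

/-- Lemma 5.4: given ordered nonempty supercomponents `W_1, …, W_k` with the backedge
property (`d(b, a) > 5r` whenever `a ∈ W_i`, `b ∈ W_j`, `i < j`), a vertex `c` with
`ε(c) ≤ r` lying entirely on the `S`-side or entirely on the `T`-side of each `W_i`
fits into the DAG-like ordering: there is a threshold index `i` with `d(w, c) ≤ 2r`
for all `w ∈ W_j`, `j < i`, and `d(c, w) ≤ 2r` for all `w ∈ W_j`, `j ≥ i`. -/
theorem stmt9 {V : Type*} [Fintype V] (d : V → V → ℝ≥0∞)
    (hrefl : ∀ v, d v v = 0)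
    (htri : ∀ u v w, d u w ≤ d u v + d v w)
    (r : ℝ≥0∞) (hr : r ≠ ⊤)
    (k : ℕ) (hk : 1 ≤ k) (W : Fin k → Set V)
    (hne : ∀ i, (W i).Nonempty)
    (hback : ∀ i j : Fin k, i < j → ∀ a ∈ W i, ∀ b ∈ W j, 5 * r < d b a)
    (c : V) (hc : (⨆ u : V, min (d u c) (d c u)) ≤ r)
    (hside : ∀ i : Fin k,
      (∀ w ∈ W i, d c w ≤ d w c) ∨ (∀ w ∈ W i, d w c ≤ d c w)) :
    ∃ i ≤ k, ∀ j : Fin k,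
      ((j : ℕ) < i → ∀ w ∈ W j, d w c ≤ 2 * r) ∧
      (i ≤ (j : ℕ) → ∀ w ∈ W j, d c w ≤ 2 * r) := by
  have hr2 : r ≤ 2 * r := by
    rw [two_mul]; exact le_self_add
  have hmin : ∀ u, min (d u c) (d c u) ≤ r := fun u => (le_iSup _ u).trans hc
  have hST : ∀ i : Fin k, (∀ w ∈ W i, d c w ≤ r) ∨ (∀ w ∈ W i, d w c ≤ r) := by
    intro i
    rcases hside i with h | h
    · left
      intro w hw
      have := hmin w
      rwa [min_eq_right (h w hw)] at this
    · right
      intro w hw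
      have := hmin w
      rwa [min_eq_left (h w hw)] at this
  have hmono : ∀ i j : Fin k, i < j → (∀ w ∈ W i, d c w ≤ r) → (∀ w ∈ W j, d c w ≤ r) := by
    intro i j hij hi
    rcases hST j with h | h
    · exact h
    · exfalso
      obtain ⟨a, ha⟩ := hne i
      obtain ⟨b, hb⟩ := hne j
      have h1 := hback i j hij a ha b hb
      have h2 : d b a ≤ 5 * r := by
        calc d b a ≤ d b c + d c a := htri _ _ _
          _ ≤ r + r := add_le_add (h b hb) (hi a ha)
          _ = 2 * r := (two_mul r).symm
          _ ≤ 5 * r := by gcongr; norm_num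
      exact absurd h1 (not_lt.mpr h2)
  classical
  have hex : ∃ n : ℕ, ∀ j : Fin k, n ≤ (j : ℕ) → ∀ w ∈ W j, d c w ≤ r :=
    ⟨k, fun j hj => absurd j.2 (not_lt.mpr hj)⟩
  refine ⟨Nat.find hex, Nat.find_min' hex fun j hj => absurd j.2 (not_lt.mpr hj), fun j => ⟨?_, ?_⟩⟩
  · intro hj w hw
    rcases hST j with h | h
    · exfalso
      refine Nat.find_min hex hj fun l hl => ?_
      rcases Nat.eq_or_lt_of_le hl with e | e
      · rwa [← Fin.ext e]
      · exact hmono j l e h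
    · exact (h w hw).trans hr2
  · intro hj w hw
    exact (Nat.find_spec hex j hj w hw).trans hr2
end

section
/- Let z ≥ 1 be an integer, let r ≥ 0 be a real number, and let w_1, …, w_m (m ≥ 1) be real numbers with 0 ≤ w_s ≤ r for every s and w_1 + ⋯ + w_m ≤ z·r. Then there exist an integer z' with 0 ≤ z' ≤ 2z − 1 and indices 0 = j_0 < j_1 < ⋯ < j_{z'+1} = m such that for every 0 ≤ t ≤ z', the partial sum w_{j_t + 1} + ⋯ + w_{j_{t+1}} is at most r. (Lemma A.1 of the paper: a directed path of total length at most z·r in which every edge has weight at most r can be divided by at most 2z − 1 vertices into subpaths each of length at most r; here the path is abstracted as its sequence of edge weights.) -/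
def BlockSplit (w : ℕ → ℝ) (r : ℝ) (n m : ℕ) : Prop :=
  ∃ j : ℕ → ℕ, j 0 = 0 ∧ j n = m ∧ (∀ t < n, j t < j (t + 1)) ∧
    (∀ t < n, ∑ s ∈ Finset.Ico (j t) (j (t + 1)), w s ≤ r)

lemma BlockSplit.snoc {w : ℕ → ℝ} {r : ℝ} {n k m : ℕ} (h : BlockSplit w r n k) (hkm : k < m)
    (hs : ∑ s ∈ Finset.Ico k m, w s ≤ r) : BlockSplit w r (n + 1) m := by
  obtain ⟨j, h0, hn, hlt, hsum⟩ := h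
  refine ⟨fun t => if t ≤ n then j t else m, by simp [h0], by simp, ?_, ?_⟩
  · intro t ht
    rcases Nat.lt_succ_iff_lt_or_eq.mp ht with h | h
    · have h1 : t ≤ n := h.le
      have h2 : t + 1 ≤ n := h
      simpa [h1, h2] using hlt t h
    · subst h
      simpa [hn] using hkm
  · intro t ht
    rcases Nat.lt_succ_iff_lt_or_eq.mp ht with h | h
    · have h1 : t ≤ n := h.le
      have h2 : t + 1 ≤ n := h
      simpa [h1, h2] using hsum t h
    · subst h
      simpa [hn] using hs

lemma BlockSplit.zero (w : ℕ → ℝ) (r : ℝ) : BlockSplit w r 0 0 :=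
  ⟨fun _ => 0, rfl, rfl, by simp, by simp⟩

lemma exists_blockSplit (w : ℕ → ℝ) (r : ℝ) (z : ℕ) : ∀ m : ℕ,
    (∀ s < m, 0 ≤ w s ∧ w s ≤ r) →
    ∑ s ∈ Finset.range m, w s ≤ ((z : ℝ) + 1) * r →
    ∃ n ≤ 2 * (z + 1), BlockSplit w r n m := by
  induction z with
  | zero =>
    intro m hw hs
    rcases Nat.eq_zero_or_pos m with rfl | hm
    · exact ⟨0, by simp, BlockSplit.zero w r⟩
    · refine ⟨1, by simp, (BlockSplit.zero w r).snoc hm ?_⟩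
      rw [← Finset.range_eq_Ico]
      simpa using hs
  | succ z ih =>
    intro m hw hs
    rcases Nat.eq_zero_or_pos m with rfl | hm
    · exact ⟨0, by simp, BlockSplit.zero w r⟩
    by_cases hle : ∑ s ∈ Finset.range m, w s ≤ r
    · refine ⟨1, by omega, (BlockSplit.zero w r).snoc hm ?_⟩
      rwa [← Finset.range_eq_Ico]
    -- the least start of a suffix of weight at most `r`
    have hex : ∃ k, ∑ s ∈ Finset.Ico k m, w s ≤ r :=
      ⟨m, by simpa using (hw 0 hm).1.trans (hw 0 hm).2⟩
    classical
    obtain ⟨k, hk, hmin⟩ : ∃ k, ∑ s ∈ Finset.Ico k m, w s ≤ r ∧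
        ∀ l < k, ¬ ∑ s ∈ Finset.Ico l m, w s ≤ r :=
      ⟨Nat.find hex, Nat.find_spec hex, fun l hl => Nat.find_min hex hl⟩
    have hk0 : k ≠ 0 := by
      rintro rfl
      rw [← Finset.range_eq_Ico] at hk
      exact hle hk
    obtain ⟨l, rfl⟩ := Nat.exists_eq_succ_of_ne_zero hk0
    have hl := hmin l (Nat.lt_succ_self l)
    have hlm : l + 1 < m := by
      by_contra hcon
      apply hl
      rcases Nat.lt_or_ge l m with h | h
      · have : m = l + 1 := by omega
        subst this
        simpa using (hw l h).2
      · rw [Finset.Ico_eq_empty_of_le h]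
        simpa using (hw 0 hm).1.trans (hw 0 hm).2
    have hsplit := Finset.sum_range_add_sum_Ico w (show l ≤ m by omega)
    push Not at hl
    obtain ⟨n, hn, hb⟩ := ih l (fun s hs => hw s (by omega)) (by
      push_cast at hs
      linarith)
    refine ⟨n + 2, by omega, (hb.snoc (Nat.lt_succ_self l) ?_).snoc hlm hk⟩
    simpa using (hw l (by omega)).2

/-- Lemma A.1: a sequence `w 0, …, w (m-1)` of edge weights with `0 ≤ w s ≤ r` and total
sum at most `z · r` can be split by at most `2z − 1` division points into consecutive
blocks each of total weight at most `r`: there are `z' ≤ 2z − 1` and indices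
`0 = j 0 < j 1 < ⋯ < j (z'+1) = m` with each block sum `∑_{s ∈ [j t, j (t+1))} w s ≤ r`. -/
theorem stmt11 (z : ℕ) (hz : 1 ≤ z) (r : ℝ) (hr : 0 ≤ r)
    (m : ℕ) (hm : 1 ≤ m) (w : ℕ → ℝ)
    (hw : ∀ s < m, 0 ≤ w s ∧ w s ≤ r)
    (hsum : ∑ s ∈ Finset.range m, w s ≤ z * r) :
    ∃ (z' : ℕ) (j : ℕ → ℕ),
      z' ≤ 2 * z - 1 ∧
      j 0 = 0 ∧ j (z' + 1) = m ∧
      (∀ t ≤ z', j t < j (t + 1)) ∧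
      (∀ t ≤ z', ∑ s ∈ Finset.Ico (j t) (j (t + 1)), w s ≤ r) := by
  obtain ⟨y, rfl⟩ : ∃ y, z = y + 1 := ⟨z - 1, by omega⟩
  obtain ⟨n, hn, j, h0, hnm, hlt, hb⟩ := exists_blockSplit w r y m hw (by
    push_cast at hsum
    exact hsum)
  obtain ⟨z', rfl⟩ : ∃ z', n = z' + 1 := by
    refine ⟨n - 1, ?_⟩
    rcases Nat.eq_zero_or_pos n with rfl | h
    · omega
    · omega
  exact ⟨z', j, by omega, h0, hnm, fun t ht => hlt t (by omega), fun t ht => hb t (by omega)⟩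
end

section
/- Let V be a finite nonempty set and let E ⊆ V × V be a relation such that for every u, v ∈ V the pair (u, v) lies in the reflexive-transitive closure of E (i.e. the directed graph (V, E) is strongly connected). Then there exists E' ⊆ E with |E'| ≤ 2(|V| − 1) such that for every u, v ∈ V the pair (u, v) lies in the reflexive-transitive closure of E' (i.e. (V, E') is still strongly connected). (Lemma A.2 of the paper.) -/
theorem exists_crossing {V : Type*} (E : V → V → Prop) (S : Finset V) {r v : V}
    (h : Relation.ReflTransGen E r v) (hr : r ∈ S) (hv : v ∉ S) :
    ∃ a b, a ∈ S ∧ b ∉ S ∧ E a b := by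
  induction h with
  | refl => exact absurd hr hv
  | @tail b c _ hbc ih =>
    by_cases hb : b ∈ S
    · exact ⟨b, c, hb, hv, hbc⟩
    · exact ih hb

theorem exists_partial_tree {V : Type*} [Fintype V] [DecidableEq V]
    (E : V → V → Prop) (r : V) (h : ∀ v, Relation.ReflTransGen E r v) (k : ℕ) :
    k + 1 ≤ Fintype.card V → ∃ (S : Finset V) (T : Finset (V × V)),
      r ∈ S ∧ S.card = k + 1 ∧ T.card ≤ k ∧ (∀ p ∈ T, E p.1 p.2) ∧
      ∀ v ∈ S, Relation.ReflTransGen (fun a b => (a, b) ∈ T) r v := by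
  induction k with
  | zero =>
    intro _
    refine ⟨{r}, ∅, by simp, by simp, by simp, by simp, ?_⟩
    intro v hv
    rw [Finset.mem_singleton.mp hv]
  | succ k ih =>
    intro hk
    obtain ⟨S, T, hr, hS, hT, hE, hreach⟩ := ih (by omega)
    have hne : ∃ v, v ∉ S := by
      by_contra! hall
      have : S = Finset.univ := Finset.eq_univ_iff_forall.mpr hall
      rw [this, Finset.card_univ] at hS
      omega
    obtain ⟨v, hv⟩ := hne
    obtain ⟨a, b, ha, hb, hab⟩ := exists_crossing E S (h v) hr hv
    have hmono : ∀ w ∈ S, Relation.ReflTransGen (fun x y => (x, y) ∈ insert (a, b) T) r w :=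
      fun w hw => Relation.ReflTransGen.mono (fun x y hxy => Finset.mem_insert_of_mem hxy) _ _ (hreach w hw)
    refine ⟨insert b S, insert (a, b) T, Finset.mem_insert_of_mem hr, ?_, ?_, ?_, ?_⟩
    · rw [Finset.card_insert_of_notMem hb, hS]
    · exact (Finset.card_insert_le _ _).trans (by omega)
    · intro p hp
      rcases Finset.mem_insert.mp hp with rfl | hp
      · exact hab
      · exact hE p hp
    · intro w hw
      rcases Finset.mem_insert.mp hw with rfl | hw
      · exact (hmono a ha).tail (Finset.mem_insert_self _ _)
      · exact hmono w hw

theorem exists_tree {V : Type*} [Fintype V] [DecidableEq V]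
    (E : V → V → Prop) (r : V) (h : ∀ v, Relation.ReflTransGen E r v) :
    ∃ T : Finset (V × V), T.card ≤ Fintype.card V - 1 ∧ (∀ p ∈ T, E p.1 p.2) ∧
      ∀ v, Relation.ReflTransGen (fun a b => (a, b) ∈ T) r v := by
  have hpos : 0 < Fintype.card V := Fintype.card_pos_iff.mpr ⟨r⟩
  obtain ⟨S, T, -, hS, hT, hE, hreach⟩ :=
    exists_partial_tree E r h (Fintype.card V - 1) (by omega)
  have hu : S = Finset.univ := (Finset.card_eq_iff_eq_univ S).mp (by omega)
  exact ⟨T, hT, hE, fun v => hreach v (by simp [hu])⟩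

/-- Lemma A.2: a strongly connected directed graph on a finite nonempty vertex set `V`
has a strongly connected subgraph with at most `2(|V| − 1)` edges. -/
theorem stmt12 {V : Type*} [Fintype V] [DecidableEq V] [Nonempty V]
    (E : V → V → Prop)
    (hconn : ∀ u v : V, Relation.ReflTransGen E u v) :
    ∃ E' : Finset (V × V),
      (∀ p ∈ E', E p.1 p.2) ∧
      E'.card ≤ 2 * (Fintype.card V - 1) ∧
      ∀ u v : V, Relation.ReflTransGen (fun a b => (a, b) ∈ E') u v := by
  obtain ⟨r⟩ := ‹Nonempty V›
  obtain ⟨T, hT, hTE, hTr⟩ := exists_tree E r (hconn r)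
  obtain ⟨U, hU, hUE, hUr⟩ := exists_tree (Function.swap E) r
    (fun v => Relation.reflTransGen_swap.mpr (hconn v r))
  refine ⟨T ∪ U.image Prod.swap, ?_, ?_, ?_⟩
  · intro p hp
    rcases Finset.mem_union.mp hp with hp | hp
    · exact hTE p hp
    · obtain ⟨q, hq, rfl⟩ := Finset.mem_image.mp hp
      exact hUE q hq
  · have h1 := Finset.card_union_le T (U.image Prod.swap)
    have h2 : (U.image Prod.swap).card ≤ U.card := Finset.card_image_le
    omega
  · intro u v
    refine Relation.ReflTransGen.trans (b := r) ?_ ?_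
    · refine Relation.ReflTransGen.mono ?_ _ _ (Relation.reflTransGen_swap.mpr (hUr u))
      intro x y hxy
      exact Finset.mem_union_right _ (Finset.mem_image.mpr ⟨(y, x), hxy, rfl⟩)
    · exact Relation.ReflTransGen.mono (fun x y hxy => Finset.mem_union_left _ hxy) _ _ (hTr v)
end
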